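/- The infinite series identity $\sum_{k=0}^{\infty}\Big(\frac{16}{27}\Big)^k\frac{((1)_k)^2}{(7/6)_k\,(11/6)_k}\cdot\frac{21+22k}{1+2k} = 30G$ holds. -/

import Mathlib

open scoped BigOperators

/-- The shifted factorial (Pochhammer symbol) `(x)_n = x (x+1) ⋯ (x+n-1)`. -/
noncomputable def poch (x : ℝ) (n : ℕ) : ℝ := ∏ i ∈ Finset.range n, (x + i)

/-- The harmonic numbers of order 2, `H_n^{(2)} = ∑_{j=1}^n 1/j²`. -/
noncomputable def H2 (n : ℕ) : ℝ := ∑ j ∈ Finset.range n, 1 / ((j : ℝ) + 1) ^ 2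

/-- The Dirichlet beta value `β(4) = ∑_{k≥0} (-1)^k/(1+2k)⁴`. -/
noncomputable def beta4 : ℝ := ∑' k : ℕ, (-1) ^ k / (1 + 2 * (k : ℝ)) ^ 4

/-- The Catalan constant `G = ∑_{k≥0} (-1)^k/(1+2k)²`. -/
noncomputable def catalanG : ℝ := ∑' k : ℕ, (-1) ^ k / (1 + 2 * (k : ℝ)) ^ 2

open Filter Topology

/-- The product of the `4n+1` consecutive half-integers `k+1/2-n, …, k+1/2+3n`. -/
noncomputable def halfIntegerProd (n k : ℕ) : ℝ :=
  ∏ i ∈ Finset.range (4 * n + 1), ((k : ℝ) + 1 / 2 - n + i)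

/-- The first member of the Wilf–Zeilberger pair; its row `n = 0` is four times the series of the
Catalan constant. -/
noncomputable def wzF (n k : ℕ) : ℝ :=
  (-1) ^ (n + k) * ((2 * n).factorial : ℝ) ^ 2 / (((k : ℝ) + 1 / 2 + n) * halfIntegerProd n k)

/-- The numerator of the rational certificate. -/
noncomputable def wzNum (n y : ℝ) : ℝ :=
  (y ^ 3 + (3 + 7 * n) * y ^ 2 + (1 + 8 * n + 11 * n ^ 2) * y
    - (4 + 19 * n + 27 * n ^ 2 + 11 * n ^ 3)) / 2

/-- The second member of the Wilf–Zeilberger pair. -/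
noncomputable def wzG (n k : ℕ) : ℝ :=
  wzF n k * (wzNum n ((k : ℝ) + 1 / 2) / (((k : ℝ) + 1 / 2 - n - 1) *
    ((k : ℝ) + 1 / 2 + 3 * n + 1) * ((k : ℝ) + 1 / 2 + 3 * n + 2)))

/-- The hypergeometric factor of the accelerated series. -/
noncomputable def accelWeight (n : ℕ) : ℝ :=
  (16 / 27 : ℝ) ^ n * (poch 1 n ^ 2 / (poch (7 / 6) n * poch (11 / 6) n))

/-- The rate at which the rows of `wzF` decay. -/
noncomputable def wzMajorant (n : ℕ) : ℝ := (6 * n + 5) ^ 2 * (16 / 27) ^ n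

lemma half_le_abs_intCast_add_half (m : ℤ) : 1 / 2 ≤ |(m : ℝ) + 1 / 2| := by
  rcases le_or_gt 0 m with h | h
  · have : (0 : ℝ) ≤ m := by exact_mod_cast h
    rw [abs_of_nonneg (by linarith)]
    linarith
  · have : (m : ℝ) ≤ -1 := by exact_mod_cast (by omega : m ≤ -1)
    rw [abs_of_nonpos (by linarith)]
    linarith

lemma half_le_abs_sub (n k : ℕ) : 1 / 2 ≤ |(k : ℝ) + 1 / 2 - n| := by
  have h := half_le_abs_intCast_add_half ((k : ℤ) - n)
  push_cast at h
  rwa [show (k : ℝ) + 1 / 2 - n = k - n + 1 / 2 by ring]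

lemma half_le_abs_sub_one (n k : ℕ) : 1 / 2 ≤ |(k : ℝ) + 1 / 2 - n - 1| := by
  have h := half_le_abs_sub (n + 1) k
  push_cast at h
  rwa [show (k : ℝ) + 1 / 2 - n - 1 = k + 1 / 2 - (n + 1) by ring]

lemma half_sub_ne_zero (n k : ℕ) : (k : ℝ) + 1 / 2 - n ≠ 0 :=
  abs_pos.mp (by linarith [half_le_abs_sub n k])

lemma half_sub_one_ne_zero (n k : ℕ) : (k : ℝ) + 1 / 2 - n - 1 ≠ 0 :=
  abs_pos.mp (by linarith [half_le_abs_sub_one n k])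

lemma halfIntegerProd_ne_zero (n k : ℕ) : halfIntegerProd n k ≠ 0 := by
  refine Finset.prod_ne_zero_iff.mpr fun i _ => ?_
  have h := half_sub_ne_zero n (k + i)
  push_cast at h
  rwa [show (k : ℝ) + 1 / 2 - n + i = k + i + 1 / 2 - n by ring]

lemma halfIntegerProd_succ_right (n k : ℕ) :
    halfIntegerProd n (k + 1) * ((k : ℝ) + 1 / 2 - n) =
      halfIntegerProd n k * ((k : ℝ) + 1 / 2 + 3 * n + 1) := by
  have h1 := Finset.prod_range_succ (fun i : ℕ => (k : ℝ) + 1 / 2 - n + i) (4 * n + 1)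
  have h2 := Finset.prod_range_succ' (fun i : ℕ => (k : ℝ) + 1 / 2 - n + i) (4 * n + 1)
  rw [h1] at h2
  have h3 : halfIntegerProd n (k + 1) =
      ∏ i ∈ Finset.range (4 * n + 1), ((k : ℝ) + 1 / 2 - n + ((i + 1 : ℕ) : ℝ)) := by
    refine Finset.prod_congr rfl fun i _ => ?_
    push_cast
    ring
  rw [h3, halfIntegerProd]
  push_cast at h2 ⊢
  linear_combination -h2

lemma halfIntegerProd_succ_left (n k : ℕ) :
    halfIntegerProd (n + 1) k = ((k : ℝ) + 1 / 2 - n - 1) * halfIntegerProd n k *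
      (((k : ℝ) + 1 / 2 + 3 * n + 1) * ((k : ℝ) + 1 / 2 + 3 * n + 2) *
        ((k : ℝ) + 1 / 2 + 3 * n + 3)) := by
  have h3 : halfIntegerProd n k =
      ∏ i ∈ Finset.range (4 * n + 1), ((k : ℝ) + 1 / 2 - (n + 1 : ℕ) + ((i + 1 : ℕ) : ℝ)) := by
    refine Finset.prod_congr rfl fun i _ => ?_
    push_cast
    ring
  rw [h3, halfIntegerProd, show 4 * (n + 1) + 1 = 4 * n + 1 + 1 + 1 + 1 + 1 by ring,
    Finset.prod_range_succ', Finset.prod_range_succ, Finset.prod_range_succ,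
    Finset.prod_range_succ]
  push_cast
  ring

lemma cast_factorial_two_mul_succ (n : ℕ) :
    ((2 * (n + 1)).factorial : ℝ) = (2 * n + 2) * (2 * n + 1) * ((2 * n).factorial : ℝ) := by
  rw [show 2 * (n + 1) = 2 * n + 1 + 1 by ring, Nat.factorial_succ, Nat.factorial_succ]
  push_cast
  ring

lemma wzF_succ_right (n k : ℕ) :
    wzF n (k + 1) = -wzF n k * (((k : ℝ) + 1 / 2 + n) * ((k : ℝ) + 1 / 2 - n)) /
      (((k : ℝ) + 1 / 2 + n + 1) * ((k : ℝ) + 1 / 2 + 3 * n + 1)) := by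
  have h1 := halfIntegerProd_ne_zero n k
  have h2 := half_sub_ne_zero n k
  have h3 : (k : ℝ) + 1 / 2 + n ≠ 0 := by positivity
  have h4 : (k : ℝ) + 1 / 2 + n + 1 ≠ 0 := by positivity
  have h5 : (k : ℝ) + 1 / 2 + 3 * n + 1 ≠ 0 := by positivity
  have h6 : halfIntegerProd n (k + 1) =
      halfIntegerProd n k * ((k : ℝ) + 1 / 2 + 3 * n + 1) / ((k : ℝ) + 1 / 2 - n) :=
    (eq_div_iff h2).mpr (halfIntegerProd_succ_right n k)
  rw [wzF, wzF, h6, ← add_assoc, pow_succ]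
  push_cast
  rw [show (k : ℝ) + 1 + 1 / 2 + n = (k : ℝ) + 1 / 2 + n + 1 by ring]
  generalize (k : ℝ) + 1 / 2 - n = a at *
  generalize (k : ℝ) + 1 / 2 + 3 * n + 1 = b at *
  generalize (k : ℝ) + 1 / 2 + n = c at *
  field_simp

lemma wzF_succ_left (n k : ℕ) :
    wzF (n + 1) k = -wzF n k * (((2 * n + 2) * (2 * n + 1)) ^ 2 * ((k : ℝ) + 1 / 2 + n)) /
      (((k : ℝ) + 1 / 2 + n + 1) * (((k : ℝ) + 1 / 2 - n - 1) * ((k : ℝ) + 1 / 2 + 3 * n + 1) *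
        ((k : ℝ) + 1 / 2 + 3 * n + 2) * ((k : ℝ) + 1 / 2 + 3 * n + 3))) := by
  have h1 := halfIntegerProd_ne_zero n k
  have h2 := half_sub_one_ne_zero n k
  have h3 : (k : ℝ) + 1 / 2 + n ≠ 0 := by positivity
  have h4 : (k : ℝ) + 1 / 2 + n + 1 ≠ 0 := by positivity
  have h5 : (k : ℝ) + 1 / 2 + 3 * n + 1 ≠ 0 := by positivity
  have h6 : (k : ℝ) + 1 / 2 + 3 * n + 2 ≠ 0 := by positivity
  have h7 : (k : ℝ) + 1 / 2 + 3 * n + 3 ≠ 0 := by positivity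
  rw [wzF, wzF, halfIntegerProd_succ_left, cast_factorial_two_mul_succ,
    show n + 1 + k = n + k + 1 by ring, pow_succ]
  push_cast
  rw [show (k : ℝ) + 1 / 2 + (n + 1) = (k : ℝ) + 1 / 2 + n + 1 by ring]
  generalize (k : ℝ) + 1 / 2 - n - 1 = a at *
  generalize (k : ℝ) + 1 / 2 + 3 * n + 1 = b at *
  generalize (k : ℝ) + 1 / 2 + 3 * n + 2 = b' at *
  generalize (k : ℝ) + 1 / 2 + 3 * n + 3 = b'' at *
  generalize (k : ℝ) + 1 / 2 + n = c at *
  field_simp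

/-- The polynomial identity behind the Wilf–Zeilberger pair. -/
lemma wzNum_identity (n y : ℝ) :
    wzNum n (y + 1) * (y - n - 1) * (y + n) + wzNum n y * (y + 3 * n + 3) * (y + n + 1) =
      ((2 * n + 2) * (2 * n + 1)) ^ 2 * (y + n) +
        (y - n - 1) * (y + 3 * n + 1) * (y + 3 * n + 2) * (y + 3 * n + 3) * (y + n + 1) := by
  unfold wzNum
  ring

lemma wz_pair (n k : ℕ) : wzF (n + 1) k - wzF n k = wzG n (k + 1) - wzG n k := by
  have h := wzNum_identity n ((k : ℝ) + 1 / 2)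
  have h1 := half_sub_ne_zero n k
  have h2 := half_sub_one_ne_zero n k
  have h3 : (k : ℝ) + 1 / 2 + n ≠ 0 := by positivity
  have h4 : (k : ℝ) + 1 / 2 + n + 1 ≠ 0 := by positivity
  have h5 : (k : ℝ) + 1 / 2 + 3 * n + 1 ≠ 0 := by positivity
  have h6 : (k : ℝ) + 1 / 2 + 3 * n + 2 ≠ 0 := by positivity
  have h7 : (k : ℝ) + 1 / 2 + 3 * n + 3 ≠ 0 := by positivity
  rw [wzG, wzG, wzF_succ_left, wzF_succ_right]
  push_cast
  rw [show (k : ℝ) + 1 + 1 / 2 = (k : ℝ) + 1 / 2 + 1 by ring]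
  generalize (k : ℝ) + 1 / 2 = y at *
  rw [show y + 1 - n - 1 = y - n by ring, show y + 1 + 3 * n + 1 = y + 3 * n + 2 by ring,
    show y + 1 + 3 * n + 2 = y + 3 * n + 3 by ring]
  generalize wzF n k = f at *
  generalize wzNum n (y + 1) = p at *
  generalize wzNum n y = q at *
  generalize ((2 * (n : ℝ) + 2) * (2 * n + 1)) ^ 2 = t at *
  generalize y - n - 1 = a at *
  generalize y - n = a' at *
  generalize y + 3 * n + 1 = b at *
  generalize y + 3 * n + 2 = b' at *
  generalize y + 3 * n + 3 = b'' at *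
  generalize y + n + 1 = c' at *
  generalize y + n = c at *
  field_simp
  linear_combination f * h

lemma poch_succ (x : ℝ) (n : ℕ) : poch x (n + 1) = poch x n * (x + n) :=
  Finset.prod_range_succ _ _

lemma poch_pos {x : ℝ} (hx : 0 < x) (n : ℕ) : 0 < poch x n :=
  Finset.prod_pos fun i _ => by positivity

lemma poch_le_poch {x y : ℝ} (hx : 0 ≤ x) (hxy : x ≤ y) (n : ℕ) : poch x n ≤ poch y n :=
  Finset.prod_le_prod (fun i _ => by positivity) fun i _ => by gcongr

lemma accelWeight_nonneg (n : ℕ) : 0 ≤ accelWeight n := by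
  have h1 := poch_pos (show (0 : ℝ) < 7 / 6 by norm_num) n
  have h2 := poch_pos (show (0 : ℝ) < 11 / 6 by norm_num) n
  unfold accelWeight
  positivity

lemma accelWeight_le (n : ℕ) : accelWeight n ≤ (16 / 27) ^ n := by
  have h0 := poch_pos (show (0 : ℝ) < 1 by norm_num) n
  have h1 := poch_pos (show (0 : ℝ) < 7 / 6 by norm_num) n
  have h2 := poch_pos (show (0 : ℝ) < 11 / 6 by norm_num) n
  refine mul_le_of_le_one_right (by positivity) ((div_le_one (by positivity)).mpr ?_)
  rw [sq]
  exact mul_le_mul (poch_le_poch (by norm_num) (by norm_num) n)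
    (poch_le_poch (by norm_num) (by norm_num) n) h0.le h1.le

lemma wzF_zero_right (n : ℕ) :
    wzF n 0 = accelWeight n * (4 * (6 * n + 5) / (5 * (2 * n + 1))) := by
  induction n with
  | zero => norm_num [wzF, accelWeight, poch, halfIntegerProd]
  | succ n ih =>
    have h1 := poch_pos (show (0 : ℝ) < 7 / 6 by norm_num) n
    have h2 := poch_pos (show (0 : ℝ) < 11 / 6 by norm_num) n
    have hn := half_sub_one_ne_zero n 0
    rw [wzF_succ_left, ih, accelWeight, accelWeight, poch_succ, poch_succ, poch_succ, pow_succ]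
    push_cast at hn ⊢
    rw [show (0 : ℝ) + 1 / 2 - n - 1 = -((2 * n + 1) / 2) by ring]
    field_simp
    ring

lemma wzG_zero_right (n : ℕ) :
    wzG n 0 = 2 / 15 * (accelWeight n * ((21 + 22 * (n : ℝ)) / (1 + 2 * n))) := by
  rw [wzG, wzF_zero_right, wzNum]
  push_cast
  rw [show (0 : ℝ) + 1 / 2 - n - 1 = -((2 * n + 1) / 2) by ring]
  field_simp
  ring

lemma halfIntegerProd_lower (n k : ℕ) :
    |halfIntegerProd n 0| * ((k : ℝ) + 1 / 2 + 3 * n) ≤ |halfIntegerProd n k| * (1 / 2 + 3 * n) := by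
  induction k with
  | zero => simp
  | succ k ih =>
    have h := congrArg abs (halfIntegerProd_succ_right n k)
    rw [abs_mul, abs_mul, abs_of_pos (by positivity : 0 < (k : ℝ) + 1 / 2 + 3 * n + 1)] at h
    have h1 : |(k : ℝ) + 1 / 2 - n| ≤ k + 1 / 2 + 3 * n := by
      rw [abs_le]
      have : (0 : ℝ) ≤ k := by positivity
      have : (0 : ℝ) ≤ n := by positivity
      constructor <;> linarith
    have h2 : 0 < |(k : ℝ) + 1 / 2 - n| := by linarith [half_le_abs_sub n k]
    push_cast
    refine le_of_mul_le_mul_right ?_ h2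
    calc |halfIntegerProd n 0| * ((k : ℝ) + 1 + 1 / 2 + 3 * n) * |(k : ℝ) + 1 / 2 - n|
        ≤ |halfIntegerProd n 0| * ((k : ℝ) + 1 + 1 / 2 + 3 * n) * (k + 1 / 2 + 3 * n) := by gcongr
      _ = |halfIntegerProd n 0| * (k + 1 / 2 + 3 * n) * ((k : ℝ) + 1 / 2 + 3 * n + 1) := by ring
      _ ≤ |halfIntegerProd n k| * (1 / 2 + 3 * n) * ((k : ℝ) + 1 / 2 + 3 * n + 1) := by gcongr
      _ = |halfIntegerProd n (k + 1)| * (1 / 2 + 3 * n) * |(k : ℝ) + 1 / 2 - n| := by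
        linear_combination -(1 / 2 + 3 * (n : ℝ)) * h

lemma abs_wzF (n k : ℕ) :
    |wzF n k| = ((2 * n).factorial : ℝ) ^ 2 / (((k : ℝ) + 1 / 2 + n) * |halfIntegerProd n k|) := by
  rw [wzF, abs_div, abs_mul, abs_mul, abs_pow, abs_neg, abs_one, one_pow, one_mul,
    abs_of_nonneg (by positivity : (0 : ℝ) ≤ ((2 * n).factorial : ℝ) ^ 2),
    abs_of_pos (by positivity : 0 < (k : ℝ) + 1 / 2 + n)]

lemma abs_wzF_le (n k : ℕ) : |wzF n k| ≤ wzMajorant n * (1 / ((k : ℝ) + 1 / 2) ^ 2) := by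
  have hD := abs_pos.mpr (halfIntegerProd_ne_zero n k)
  have hD0 := abs_pos.mpr (halfIntegerProd_ne_zero n 0)
  have h1 : |wzF n k| ≤
      |wzF n 0| * ((1 / 2 + n) * (1 / 2 + 3 * n)) / (((k : ℝ) + 1 / 2) ^ 2) := by
    rw [abs_wzF, abs_wzF, le_div_iff₀ (by positivity), div_mul_eq_mul_div, div_mul_eq_mul_div,
      div_le_div_iff₀ (by positivity) (by positivity)]
    push_cast
    have h := halfIntegerProd_lower n k
    have hn : (0 : ℝ) ≤ n := by positivity
    have h2 : |halfIntegerProd n 0| * ((k : ℝ) + 1 / 2) ≤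
        |halfIntegerProd n 0| * ((k : ℝ) + 1 / 2 + 3 * n) :=
      mul_le_mul_of_nonneg_left (by linarith) hD0.le
    calc ((2 * n).factorial : ℝ) ^ 2 * ((k : ℝ) + 1 / 2) ^ 2 *
          ((0 + 1 / 2 + n) * |halfIntegerProd n 0|)
        = ((2 * n).factorial : ℝ) ^ 2 * ((k : ℝ) + 1 / 2) * (1 / 2 + n) *
          (|halfIntegerProd n 0| * ((k : ℝ) + 1 / 2)) := by ring
      _ ≤ ((2 * n).factorial : ℝ) ^ 2 * ((k : ℝ) + 1 / 2 + n) * (1 / 2 + n) *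
          (|halfIntegerProd n k| * (1 / 2 + 3 * n)) := by
        refine mul_le_mul ?_ (h2.trans h) (by positivity) (by positivity)
        gcongr ?_ * ?_ * _
        linarith
      _ = _ := by ring
  refine h1.trans ?_
  rw [mul_one_div]
  refine div_le_div_of_nonneg_right ?_ (by positivity)
  have hw := accelWeight_nonneg n
  rw [wzF_zero_right, abs_of_nonneg (by positivity)]
  calc accelWeight n * (4 * (6 * n + 5) / (5 * (2 * n + 1))) * ((1 / 2 + n) * (1 / 2 + 3 * n))
      = accelWeight n * ((6 * n + 5) * (6 * n + 1) / 5) := by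
        field_simp
        ring
    _ ≤ (16 / 27) ^ n * (6 * n + 5) ^ 2 := by
        refine mul_le_mul (accelWeight_le n) ?_ (by positivity) (by positivity)
        have hn : (0 : ℝ) ≤ n := by positivity
        nlinarith
    _ = wzMajorant n := by rw [wzMajorant, mul_comm]

lemma tendsto_wzMajorant : Tendsto wzMajorant atTop (𝓝 0) := by
  have hr : |(16 / 27 : ℝ)| < 1 := by norm_num [abs_lt]
  have h := (((tendsto_pow_const_mul_const_pow_of_abs_lt_one 2 hr).const_mul 36).add
    ((tendsto_pow_const_mul_const_pow_of_abs_lt_one 1 hr).const_mul 60)).add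
    ((tendsto_pow_const_mul_const_pow_of_abs_lt_one 0 hr).const_mul 25)
  simp only [mul_zero, add_zero] at h
  refine h.congr fun n => ?_
  rw [wzMajorant]
  ring

lemma summable_one_div_half_sq : Summable fun k : ℕ => 1 / ((k : ℝ) + 1 / 2) ^ 2 := by
  refine ((summable_nat_add_iff 1).mpr
    (Real.summable_one_div_nat_pow.mpr one_lt_two)).mul_left 4 |>.of_nonneg_of_le
    (fun k => by positivity) fun k => ?_
  push_cast
  rw [mul_one_div, div_le_div_iff₀ (by positivity) (by positivity)]
  have : (0 : ℝ) ≤ k := by positivity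
  nlinarith

lemma summable_wzF (n : ℕ) : Summable (wzF n) :=
  .of_norm_bounded (summable_one_div_half_sq.mul_left _) fun k => abs_wzF_le n k

lemma abs_wzNum_le (n : ℕ) {y : ℝ} (hy : 1 / 2 ≤ y) :
    |wzNum n y| ≤ (43 + 198 * n + 260 * (n : ℝ) ^ 2 + 88 * (n : ℝ) ^ 3) * y ^ 3 := by
  have hn : (0 : ℝ) ≤ n := by positivity
  have h1 : y ^ 2 ≤ 2 * y ^ 3 := by nlinarith [sq_nonneg y]
  have h2 : y ≤ 4 * y ^ 3 := by nlinarith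
  have h3 : 1 ≤ 8 * y ^ 3 := by nlinarith
  have e1 : (3 + 7 * (n : ℝ)) * y ^ 2 ≤ (3 + 7 * n) * (2 * y ^ 3) := by gcongr
  have e2 : (1 + 8 * (n : ℝ) + 11 * (n : ℝ) ^ 2) * y ≤
      (1 + 8 * n + 11 * (n : ℝ) ^ 2) * (4 * y ^ 3) := by gcongr
  have e3 : (4 + 19 * (n : ℝ) + 27 * (n : ℝ) ^ 2 + 11 * (n : ℝ) ^ 3) * 1 ≤
      (4 + 19 * n + 27 * (n : ℝ) ^ 2 + 11 * (n : ℝ) ^ 3) * (8 * y ^ 3) := by gcongr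
  have p0 : 0 ≤ y ^ 3 := by positivity
  have p1 : 0 ≤ (3 + 7 * (n : ℝ)) * y ^ 2 := by positivity
  have p2 : 0 ≤ (1 + 8 * (n : ℝ) + 11 * (n : ℝ) ^ 2) * y := by positivity
  have p3 : 0 ≤ 4 + 19 * (n : ℝ) + 27 * (n : ℝ) ^ 2 + 11 * (n : ℝ) ^ 3 := by positivity
  have q1 : 0 ≤ n * y ^ 3 := by positivity
  have q2 : 0 ≤ (n : ℝ) ^ 2 * y ^ 3 := by positivity
  have q3 : 0 ≤ (n : ℝ) ^ 3 * y ^ 3 := by positivity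
  rw [wzNum, abs_le]
  constructor <;> nlinarith

lemma tendsto_wzG (n : ℕ) : Tendsto (wzG n) atTop (𝓝 0) := by
  obtain ⟨C, hC⟩ : ∃ C : ℝ, C = 43 + 198 * n + 260 * (n : ℝ) ^ 2 + 88 * (n : ℝ) ^ 3 := ⟨_, rfl⟩
  have hC0 : 0 ≤ C := hC ▸ by positivity
  have hlim : Tendsto (fun k : ℕ => 2 * C * wzMajorant n * ((k : ℝ) + 1 / 2)⁻¹) atTop (𝓝 0) := by
    have h : Tendsto (fun k : ℕ => (k : ℝ) + 1 / 2) atTop atTop :=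
      tendsto_atTop_add_const_right _ _ tendsto_natCast_atTop_atTop
    simpa using h.inv_tendsto_atTop.const_mul (2 * C * wzMajorant n)
  refine squeeze_zero_norm (fun k => ?_) hlim
  have hn : (0 : ℝ) ≤ n := by positivity
  have hM : 0 ≤ wzMajorant n := by
    unfold wzMajorant
    positivity
  have hy : (1 : ℝ) / 2 ≤ k + 1 / 2 := by linarith [(Nat.cast_nonneg k : (0 : ℝ) ≤ k)]
  have hF := abs_wzF_le n k
  have hN := abs_wzNum_le n hy
  have hd := half_le_abs_sub_one n k
  rw [← hC] at hN
  rw [wzG, Real.norm_eq_abs, abs_mul, abs_div, abs_mul, abs_mul,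
    abs_of_pos (by positivity : 0 < (k : ℝ) + 1 / 2 + 3 * n + 1),
    abs_of_pos (by positivity : 0 < (k : ℝ) + 1 / 2 + 3 * n + 2)]
  generalize (k : ℝ) + 1 / 2 = y at *
  have hy0 : 0 < y := by linarith
  calc |wzF n k| * (|wzNum n y| / (|y - n - 1| * (y + 3 * n + 1) * (y + 3 * n + 2)))
      ≤ wzMajorant n * (1 / y ^ 2) * (C * y ^ 3 / (1 / 2 * y * y)) := by
        gcongr <;> linarith
    _ = 2 * C * wzMajorant n * y⁻¹ := by
        field_simp

lemma tsum_wzF_sub_succ (n : ℕ) : ∑' k, wzF n k - ∑' k, wzF (n + 1) k = wzG n 0 := by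
  have h1 := ((summable_wzF (n + 1)).hasSum.sub (summable_wzF n).hasSum).tendsto_sum_nat
  have h2 : Tendsto (fun K => wzG n K - wzG n 0) atTop (𝓝 (0 - wzG n 0)) :=
    (tendsto_wzG n).sub_const _
  have h3 : (fun K => ∑ k ∈ Finset.range K, (wzF (n + 1) k - wzF n k)) =
      fun K => wzG n K - wzG n 0 := by
    funext K
    simp only [wz_pair, Finset.sum_range_sub]
  rw [h3] at h1
  linarith [tendsto_nhds_unique h1 h2]

lemma tendsto_tsum_wzF : Tendsto (fun n => ∑' k, wzF n k) atTop (𝓝 0) := by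
  refine squeeze_zero_norm (a := fun n => wzMajorant n * ∑' k : ℕ, 1 / ((k : ℝ) + 1 / 2) ^ 2)
    (fun n => ?_) (by simpa only [zero_mul] using tendsto_wzMajorant.mul_const _)
  exact tsum_of_norm_bounded (summable_one_div_half_sq.hasSum.mul_left _)
    fun k => abs_wzF_le n k

lemma tsum_wzF_zero_left : ∑' k, wzF 0 k = 4 * catalanG := by
  rw [catalanG, ← tsum_mul_left]
  refine tsum_congr fun k => ?_
  simp only [wzF, halfIntegerProd]
  simp
  field_simp
  ring

lemma hasSum_wzG_zero_right : HasSum (fun n => wzG n 0) (4 * catalanG) := by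
  have h0 : ∀ n, 0 ≤ wzG n 0 := fun n => by
    have := accelWeight_nonneg n
    rw [wzG_zero_right]
    positivity
  rw [hasSum_iff_tendsto_nat_of_nonneg h0]
  have h : (fun N => ∑ n ∈ Finset.range N, wzG n 0) =
      fun N => ∑' k, wzF 0 k - ∑' k, wzF N k := by
    funext N
    simp only [← tsum_wzF_sub_succ]
    exact Finset.sum_range_sub' (fun n => ∑' k, wzF n k) N
  rw [h, tsum_wzF_zero_left]
  simpa using tendsto_tsum_wzF.const_sub (4 * catalanG)

theorem stmt17 :
    (∑' k : ℕ, (16/27 : ℝ) ^ k * (poch 1 k ^ 2 / (poch (7/6) k * poch (11/6) k)) *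
      ((21 + 22 * (k : ℝ)) / (1 + 2 * (k : ℝ)))) = 30 * catalanG := by
  have h := hasSum_wzG_zero_right.mul_left (15 / 2)
  rw [show 15 / 2 * (4 * catalanG) = 30 * catalanG by ring] at h
  rw [← h.tsum_eq]
  refine tsum_congr fun k => ?_
  rw [wzG_zero_right, accelWeight]
  ring
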